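/- Fix b > 0 and β > 0 with b·β > 1, and let p₊(β) be the unique p ∈ (0,1) with p = tanh(b·β·p). With f_N and f as above (f_N(q) = (β·N)⁻¹·log Σ_{k=0}^{N} (N choose k)·exp(β·N·(q·m_k + b·m_k²/2)), f(q) = sup_{m∈[−1,1]}(q·m + b·m²/2 − β⁻¹·c(m))), let I ⊂ ℝ be a compact interval containing 0 in its interior. Then the sets Ā_N := { (f_N'(q), q, f_N(q)) : q ∈ I } ⊂ ℝ³ converge, in the Hausdorff distance, to the compact set L := { (f'(q), q, f(q)) : q ∈ I, q ≠ 0 } ∪ { (s, 0, f(0)) : s ∈ [−p₊(β), p₊(β)] }, i.e. the union of the stable branches of the limiting Curie–Weiss Legendrian over I with the vertical segment over q = 0 joining them. -/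

import Mathlib

open Finset Filter

/-- The symmetrized entropy function
`c(m) = ((1+m)/2)·log((1+m)/2) + ((1−m)/2)·log((1−m)/2)` (with `c(±1) = 0`,
as `Real.log 0 = 0` in Lean). -/
noncomputable def cEnt (m : ℝ) : ℝ :=
  ((1 + m) / 2) * Real.log ((1 + m) / 2) + ((1 - m) / 2) * Real.log ((1 - m) / 2)

/-- The dual (Hubbard–Stratonovich) Curie–Weiss functional. -/
noncomputable def cwDual (b β q m : ℝ) : ℝ :=
  β⁻¹ * Real.log (2 * Real.cosh (β * (q + b * m))) - b * m ^ 2 / 2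

/-- The Curie–Weiss variational functional, whose supremum over `m ∈ [-1, 1]` is the limiting
pressure. -/
noncomputable def cwPrimal (b β q m : ℝ) : ℝ :=
  q * m + b * m ^ 2 / 2 - β⁻¹ * cEnt m

lemma cEnt_neg (m : ℝ) : cEnt (-m) = cEnt m := by
  unfold cEnt
  rw [sub_neg_eq_add, ← sub_eq_add_neg, add_comm]

lemma two_cosh_pos (u : ℝ) : 0 < 2 * Real.cosh u := by
  have := Real.cosh_pos u
  positivity

lemma mul_sub_log_le {x C : ℝ} (v : ℝ) (hx : 0 ≤ x) (hC : 0 < C) :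
    x * (v - Real.log x - Real.log C) ≤ Real.exp v / C - x := by
  rcases hx.eq_or_lt with rfl | hx
  · simp only [zero_mul, sub_zero]
    positivity
  · have h := Real.log_le_sub_one_of_pos (show 0 < Real.exp v / (x * C) by positivity)
    rw [Real.log_div (Real.exp_ne_zero v) (by positivity), Real.log_exp,
      Real.log_mul hx.ne' hC.ne'] at h
    calc x * (v - Real.log x - Real.log C) = x * (v - (Real.log x + Real.log C)) := by ring
      _ ≤ x * (Real.exp v / (x * C) - 1) := by gcongr
      _ = Real.exp v / C - x := by field_simp

/-- Fenchel–Young inequality for the entropy and `log (2 cosh)`. -/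
lemma mul_sub_cEnt_le {m : ℝ} (u : ℝ) (hm : m ∈ Set.Icc (-1 : ℝ) 1) :
    u * m - cEnt m ≤ Real.log (2 * Real.cosh u) := by
  have hC := two_cosh_pos u
  have h1 := mul_sub_log_le u (show 0 ≤ (1 + m) / 2 by linarith [hm.1]) hC
  have h2 := mul_sub_log_le (-u) (show 0 ≤ (1 - m) / 2 by linarith [hm.2]) hC
  have h3 : Real.exp u / (2 * Real.cosh u) + Real.exp (-u) / (2 * Real.cosh u) = 1 := by
    rw [← add_div, Real.cosh_eq, div_eq_one_iff_eq (by positivity)]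
    ring
  unfold cEnt
  linarith

lemma mul_tanh_sub_cEnt (u : ℝ) :
    u * Real.tanh u - cEnt (Real.tanh u) = Real.log (2 * Real.cosh u) := by
  have hC := two_cosh_pos u
  have hc := Real.cosh_pos u
  have e1 : (1 + Real.tanh u) / 2 = Real.exp u / (2 * Real.cosh u) := by
    rw [Real.tanh_eq_sinh_div_cosh, ← Real.cosh_add_sinh]
    field_simp
  have e2 : (1 - Real.tanh u) / 2 = Real.exp (-u) / (2 * Real.cosh u) := by
    rw [Real.tanh_eq_sinh_div_cosh, ← Real.cosh_sub_sinh]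
    field_simp
  have l1 : Real.log ((1 + Real.tanh u) / 2) = u - Real.log (2 * Real.cosh u) := by
    rw [e1, Real.log_div (Real.exp_ne_zero _) hC.ne', Real.log_exp]
  have l2 : Real.log ((1 - Real.tanh u) / 2) = -u - Real.log (2 * Real.cosh u) := by
    rw [e2, Real.log_div (Real.exp_ne_zero _) hC.ne', Real.log_exp]
  unfold cEnt
  rw [l1, l2]
  ring

lemma cwPrimal_le_cwDual {b β q m : ℝ} (hβ : 0 < β) (hm : m ∈ Set.Icc (-1 : ℝ) 1) :
    cwPrimal b β q m ≤ cwDual b β q m := by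
  have h := mul_le_mul_of_nonneg_left (mul_sub_cEnt_le (β * (q + b * m)) hm)
    (inv_pos.2 hβ).le
  have e : β⁻¹ * (β * (q + b * m) * m - cEnt m) = (q + b * m) * m - β⁻¹ * cEnt m := by
    field_simp
  rw [e] at h
  unfold cwPrimal cwDual
  linarith

lemma cwPrimal_eq_cwDual {b β q m : ℝ} (hβ : 0 < β) (hm : Real.tanh (β * (q + b * m)) = m) :
    cwPrimal b β q m = cwDual b β q m := by
  have h := mul_tanh_sub_cEnt (β * (q + b * m))
  rw [hm] at h
  unfold cwPrimal cwDual
  rw [← h]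
  field_simp
  ring

lemma strictConcaveOn_tanh : StrictConcaveOn ℝ (Set.Ici 0) Real.tanh := by
  have hd : ∀ x, HasDerivAt Real.tanh (1 / Real.cosh x ^ 2) x := by
    intro x
    have h := (Real.hasDerivAt_sinh x).div (Real.hasDerivAt_cosh x) (Real.cosh_pos x).ne'
    have e : Real.sinh / Real.cosh = Real.tanh := by
      ext y
      exact (Real.tanh_eq_sinh_div_cosh y).symm
    rw [e] at h
    exact h.congr_deriv (by rw [← sq, ← sq, Real.cosh_sq_sub_sinh_sq])
  refine StrictAntiOn.strictConcaveOn_of_deriv (convex_Ici 0)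
    (fun x _ => (hd x).continuousAt.continuousWithinAt) ?_
  intro x hx y hy hxy
  rw [interior_Ici] at hx hy
  rw [(hd x).deriv, (hd y).deriv]
  have hx0 : 0 < x := hx
  have h : Real.cosh x < Real.cosh y :=
    Real.cosh_lt_cosh.2 (by rwa [abs_of_pos hx0, abs_of_pos (hx0.trans hxy)])
  have := Real.cosh_pos x
  gcongr

lemma continuous_tanh : Continuous Real.tanh := by
  have e : Real.tanh = fun x => Real.sinh x / Real.cosh x := by
    ext y
    exact Real.tanh_eq_sinh_div_cosh y
  rw [e]
  exact Real.continuous_sinh.div Real.continuous_cosh fun x => (Real.cosh_pos x).ne'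

lemma strictConcaveOn_meanField {b β q : ℝ} (hb : 0 < b) (hβ : 0 < β) (hq : 0 ≤ q) :
    StrictConcaveOn ℝ (Set.Ici 0) fun m => Real.tanh (β * (q + b * m)) - m := by
  refine ⟨convex_Ici 0, ?_⟩
  intro x hx y hy hxy s t hs ht hst
  have hx' : 0 ≤ x := hx
  have hy' : 0 ≤ y := hy
  have h := strictConcaveOn_tanh.2 (x := β * (q + b * x)) (y := β * (q + b * y))
    (by simp only [Set.mem_Ici]; positivity) (by simp only [Set.mem_Ici]; positivity)
    (fun h => hxy (by
      have h1 := mul_left_cancel₀ hβ.ne' h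
      exact mul_left_cancel₀ hb.ne' (add_left_cancel h1))) hs ht hst
  have e : s • (β * (q + b * x)) + t • (β * (q + b * y)) = β * (q + b * (s • x + t • y)) := by
    simp only [smul_eq_mul]
    linear_combination β * q * hst
  rw [e] at h
  simp only [smul_eq_mul] at h ⊢
  linarith

/-- `M` is the positive solution of the mean-field equation `m = tanh (β (q + b m))`, where
`m - tanh (β (q + b m))` changes sign. -/
structure IsMeanFieldRoot (b β q M : ℝ) : Prop where
  pos : 0 < M
  lt_one : M < 1
  eq : Real.tanh (β * (q + b * M)) = M
  lt_tanh : ∀ m, 0 < m → m < M → m < Real.tanh (β * (q + b * m))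
  tanh_lt : ∀ m, M < m → Real.tanh (β * (q + b * m)) < m

lemma tanh_nonneg_of_nonneg {u : ℝ} (hu : 0 ≤ u) : 0 ≤ Real.tanh u := by
  rw [Real.tanh_eq_sinh_div_cosh]
  exact div_nonneg (Real.sinh_nonneg_iff.2 hu) (Real.cosh_pos u).le

lemma isMeanFieldRoot_of_eq {b β q M : ℝ} (hb : 0 < b) (hβ : 0 < β) (hq : 0 ≤ q)
    (hM : 0 < M) (hM1 : M < 1) (h : Real.tanh (β * (q + b * M)) = M) :
    IsMeanFieldRoot b β q M := by
  have hc := strictConcaveOn_meanField hb hβ hq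
  have h0 : 0 ≤ Real.tanh (β * (q + b * 0)) - 0 := by
    rw [sub_zero]
    exact tanh_nonneg_of_nonneg (by rw [mul_zero, add_zero]; positivity)
  refine ⟨hM, hM1, h, fun m hm hmM => ?_, fun m hmM => ?_⟩
  · have key := hc.2 (Set.mem_Ici.2 (le_refl (0 : ℝ))) (Set.mem_Ici.2 hM.le) hM.ne
      (show 0 < 1 - m / M by rw [sub_pos, div_lt_one hM]; exact hmM)
      (show 0 < m / M by positivity) (by ring)
    have e : (1 - m / M) • (0 : ℝ) + (m / M) • M = m := by
      simp only [smul_eq_mul]; field_simp; ring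
    rw [e] at key
    simp only [smul_eq_mul] at key
    have : 0 ≤ (1 - m / M) * (Real.tanh (β * (q + b * 0)) - 0) :=
      mul_nonneg (by rw [sub_nonneg, div_le_one hM]; exact hmM.le) h0
    have hz : m / M * (Real.tanh (β * (q + b * M)) - M) = 0 := by rw [h, sub_self, mul_zero]
    rw [hz] at key
    linarith
  · have hm : 0 < m := hM.trans hmM
    have key := hc.2 (Set.mem_Ici.2 (le_refl (0 : ℝ))) (Set.mem_Ici.2 hm.le) hm.ne
      (show 0 < 1 - M / m by rw [sub_pos, div_lt_one hm]; exact hmM)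
      (show 0 < M / m by positivity) (by ring)
    have e : (1 - M / m) • (0 : ℝ) + (M / m) • m = M := by
      simp only [smul_eq_mul]; field_simp; ring
    rw [e] at key
    simp only [smul_eq_mul] at key
    have : 0 ≤ (1 - M / m) * (Real.tanh (β * (q + b * 0)) - 0) :=
      mul_nonneg (by rw [sub_nonneg, div_le_one hm]; exact hmM.le) h0
    rw [h, sub_self] at key
    have h2 : (M / m) * (Real.tanh (β * (q + b * m)) - m) < 0 := by linarith
    have h3 := (pos_iff_neg_of_mul_neg h2).1 (by positivity)
    linarith

lemma exists_isMeanFieldRoot {b β q : ℝ} (hb : 0 < b) (hβ : 0 < β) (hq : 0 < q) :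
    ∃ M, IsMeanFieldRoot b β q M := by
  have hcont : ContinuousOn (fun m => Real.tanh (β * (q + b * m)) - m) (Set.Icc 0 1) := by
    have := continuous_tanh
    fun_prop
  have h1 : Real.tanh (β * (q + b * 1)) - 1 < 0 := by
    linarith [Real.tanh_lt_one (β * (q + b * 1))]
  have h0 : 0 < Real.tanh (β * (q + b * 0)) - 0 := by
    rw [sub_zero, mul_zero, add_zero, Real.tanh_eq_sinh_div_cosh]
    exact div_pos (Real.sinh_pos_iff.2 (by positivity)) (Real.cosh_pos _)
  obtain ⟨M, hM, hM0⟩ := intermediate_value_Ioo' zero_le_one hcont ⟨h1, h0⟩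
  exact ⟨M, isMeanFieldRoot_of_eq hb hβ hq.le hM.1 hM.2 (by simpa [sub_eq_zero] using hM0)⟩

lemma hasDerivAt_cwDual {b β : ℝ} (hβ : 0 < β) (q m : ℝ) :
    HasDerivAt (cwDual b β q) (b * (Real.tanh (β * (q + b * m)) - m)) m := by
  have hu : HasDerivAt (fun m => β * (q + b * m)) (β * (b * 1)) m :=
    (((hasDerivAt_id m).const_mul b).const_add q).const_mul β
  have h1 := ((hu.cosh.const_mul 2).log (two_cosh_pos _).ne').const_mul β⁻¹
  have h2 := (((hasDerivAt_id m).pow 2).const_mul b).div_const 2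
  have h := h1.sub h2
  refine h.congr_deriv ?_
  have hc := Real.cosh_pos (β * (q + b * m))
  rw [Real.tanh_eq_sinh_div_cosh]
  simp only [id]
  field_simp
  push_cast
  ring

lemma IsMeanFieldRoot.cwDual_le {b β q M : ℝ} (hb : 0 < b) (hβ : 0 < β) (hq : 0 ≤ q)
    (h : IsMeanFieldRoot b β q M) (m : ℝ) : cwDual b β q m ≤ cwDual b β q M := by
  have hcont : Continuous (cwDual b β q) :=
    continuous_iff_continuousAt.2 fun m => (hasDerivAt_cwDual hβ q m).continuousAt
  have hnonneg : ∀ m, 0 ≤ m → cwDual b β q m ≤ cwDual b β q M := by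
    intro m hm
    rcases le_total m M with hmM | hmM
    · refine monotoneOn_of_deriv_nonneg (convex_Icc 0 M) hcont.continuousOn
        (fun x _ => (hasDerivAt_cwDual hβ q x).differentiableAt.differentiableWithinAt) ?_
        ⟨hm, hmM⟩ ⟨h.pos.le, le_rfl⟩ hmM
      intro x hx
      rw [interior_Icc] at hx
      rw [(hasDerivAt_cwDual hβ q x).deriv]
      exact mul_nonneg hb.le (sub_nonneg.2 (h.lt_tanh x hx.1 hx.2).le)
    · refine antitoneOn_of_deriv_nonpos (convex_Ici M) hcont.continuousOn
        (fun x _ => (hasDerivAt_cwDual hβ q x).differentiableAt.differentiableWithinAt) ?_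
        (Set.mem_Ici.2 le_rfl) hmM hmM
      intro x hx
      rw [interior_Ici] at hx
      rw [(hasDerivAt_cwDual hβ q x).deriv]
      exact mul_nonpos_of_nonneg_of_nonpos hb.le (sub_nonpos.2 (h.tanh_lt x hx).le)
  rcases le_total 0 m with hm | hm
  · exact hnonneg m hm
  · refine le_trans ?_ (hnonneg (-m) (by linarith))
    unfold cwDual
    rw [neg_sq]
    have : Real.cosh (β * (q + b * m)) ≤ Real.cosh (β * (q + b * -m)) := by
      rw [Real.cosh_le_cosh, abs_mul, abs_mul]
      refine mul_le_mul_of_nonneg_left ?_ (abs_nonneg _)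
      have : b * m ≤ 0 := mul_nonpos_of_nonneg_of_nonpos hb.le hm
      rw [abs_le]
      constructor <;> rw [abs_of_nonneg (by nlinarith)] <;> nlinarith
    have := two_cosh_pos (β * (q + b * m))
    gcongr

/-- `s` is a subgradient of `f` at `q`. -/
def IsSubgradientAt (f : ℝ → ℝ) (q s : ℝ) : Prop :=
  ∀ x, f q + s * (x - q) ≤ f x

/-- `f` is the limiting Curie–Weiss pressure. -/
def IsPressure (b β : ℝ) (f : ℝ → ℝ) : Prop :=
  ∀ q, f q = sSup (cwPrimal b β q '' Set.Icc (-1 : ℝ) 1)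

lemma IsSubgradientAt.eq_of_hasDerivAt {f : ℝ → ℝ} {q s d : ℝ} (h : IsSubgradientAt f q s)
    (hd : HasDerivAt f d q) : s = d := by
  have hmin : IsLocalMin (fun x => f x - s * (x - q)) q := by
    refine Eventually.of_forall fun x => ?_
    have := h x
    simp only [sub_self, mul_zero, sub_zero]
    linarith
  have h1 : HasDerivAt (fun x => f x - s * (x - q)) (d - s * 1) q :=
    hd.sub (((hasDerivAt_id q).sub_const q).const_mul s)
  have := hmin.hasDerivAt_eq_zero h1
  linarith

lemma IsMeanFieldRoot.mem_Icc {b β q M : ℝ} (h : IsMeanFieldRoot b β q M) :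
    M ∈ Set.Icc (-1 : ℝ) 1 :=
  ⟨by linarith [h.pos], h.lt_one.le⟩

lemma IsPressure.neg {b β : ℝ} {f : ℝ → ℝ} (hf : IsPressure b β f) (q : ℝ) : f (-q) = f q := by
  rw [hf, hf]
  congr 1
  have key : ∀ q m, cwPrimal b β (-q) (-m) = cwPrimal b β q m := by
    intro q m
    unfold cwPrimal
    rw [cEnt_neg]
    ring
  ext y
  constructor
  · rintro ⟨m, hm, rfl⟩
    refine ⟨-m, ⟨by linarith [hm.2], by linarith [hm.1]⟩, ?_⟩
    rw [← key, neg_neg]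
  · rintro ⟨m, hm, rfl⟩
    exact ⟨-m, ⟨by linarith [hm.2], by linarith [hm.1]⟩, key q m⟩

lemma IsPressure.eq_cwDual {b β : ℝ} {f : ℝ → ℝ} (hf : IsPressure b β f) (hb : 0 < b)
    (hβ : 0 < β) {q M : ℝ} (hq : 0 ≤ q) (h : IsMeanFieldRoot b β q M) :
    f q = cwDual b β q M := by
  rw [hf]
  refine IsGreatest.csSup_eq ⟨⟨M, h.mem_Icc, cwPrimal_eq_cwDual hβ h.eq⟩, ?_⟩
  rintro _ ⟨m, hm, rfl⟩
  exact (cwPrimal_le_cwDual hβ hm).trans (h.cwDual_le hb hβ hq m)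

lemma exists_isMeanFieldRoot_of_nonneg {b β p q : ℝ} (hb : 0 < b) (hβ : 0 < β)
    (hp : IsMeanFieldRoot b β 0 p) (hq : 0 ≤ q) : ∃ M, IsMeanFieldRoot b β q M := by
  rcases hq.eq_or_lt with rfl | hq
  · exact ⟨p, hp⟩
  · exact exists_isMeanFieldRoot hb hβ hq

lemma IsPressure.exists_eq_cwDual {b β p : ℝ} {f : ℝ → ℝ} (hf : IsPressure b β f) (hb : 0 < b)
    (hβ : 0 < β) (hp : IsMeanFieldRoot b β 0 p) (q : ℝ) :
    ∃ M, f q = cwDual b β q M ∧ ∀ m, cwDual b β q m ≤ f q := by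
  have key : ∀ q, 0 ≤ q → ∃ M, f q = cwDual b β q M ∧ ∀ m, cwDual b β q m ≤ f q := by
    intro q hq
    obtain ⟨M, hM⟩ := exists_isMeanFieldRoot_of_nonneg hb hβ hp hq
    have e := hf.eq_cwDual hb hβ hq hM
    exact ⟨M, e, fun m => e ▸ hM.cwDual_le hb hβ hq m⟩
  have hneg : ∀ q m, cwDual b β (-q) (-m) = cwDual b β q m := by
    intro q m
    unfold cwDual
    rw [show β * (-q + b * -m) = -(β * (q + b * m)) by ring, Real.cosh_neg, neg_sq]
  rcases le_total 0 q with hq | hq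
  · exact key q hq
  · obtain ⟨M, h1, h2⟩ := key (-q) (by linarith)
    rw [hf.neg] at h1 h2
    refine ⟨-M, ?_, fun m => ?_⟩
    · rw [h1, ← hneg, neg_neg]
    · rw [← hneg]
      exact h2 _

lemma IsPressure.isSubgradientAt {b β p : ℝ} {f : ℝ → ℝ} (hf : IsPressure b β f) (hb : 0 < b)
    (hβ : 0 < β) (hp : IsMeanFieldRoot b β 0 p) {q M : ℝ} (hq : 0 ≤ q)
    (h : IsMeanFieldRoot b β q M) : IsSubgradientAt f q M := by
  intro x
  obtain ⟨-, -, h1⟩ := hf.exists_eq_cwDual hb hβ hp x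
  have h2 := (cwPrimal_le_cwDual (q := x) hβ h.mem_Icc).trans (h1 M)
  rw [hf.eq_cwDual hb hβ hq h, ← cwPrimal_eq_cwDual hβ h.eq]
  refine le_trans (le_of_eq ?_) h2
  unfold cwPrimal
  ring

lemma IsPressure.isSubgradientAt_neg {b β : ℝ} {f : ℝ → ℝ} (hf : IsPressure b β f)
    {q s : ℝ} (h : IsSubgradientAt f q s) : IsSubgradientAt f (-q) (-s) := by
  intro x
  have := h (-x)
  rw [hf.neg] at this ⊢
  linarith

lemma IsPressure.exists_isSubgradientAt {b β p : ℝ} {f : ℝ → ℝ} (hf : IsPressure b β f)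
    (hb : 0 < b) (hβ : 0 < β) (hp : IsMeanFieldRoot b β 0 p) (q : ℝ) :
    ∃ s, |s| ≤ 1 ∧ IsSubgradientAt f q s := by
  rcases le_total 0 q with hq | hq
  · obtain ⟨M, hM⟩ := exists_isMeanFieldRoot_of_nonneg hb hβ hp hq
    exact ⟨M, abs_le.2 hM.mem_Icc, hf.isSubgradientAt hb hβ hp hq hM⟩
  · obtain ⟨M, hM⟩ := exists_isMeanFieldRoot_of_nonneg hb hβ hp (neg_nonneg.2 hq)
    refine ⟨-M, by rw [abs_neg]; exact abs_le.2 hM.mem_Icc, ?_⟩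
    have := hf.isSubgradientAt_neg (hf.isSubgradientAt hb hβ hp (neg_nonneg.2 hq) hM)
    rwa [neg_neg] at this

lemma continuous_of_exists_isSubgradientAt {f : ℝ → ℝ}
    (h : ∀ q, ∃ s, |s| ≤ 1 ∧ IsSubgradientAt f q s) : Continuous f := by
  have : LipschitzWith 1 f := by
    refine LipschitzWith.of_le_add fun x y => ?_
    obtain ⟨s, hs, hsub⟩ := h x
    have h1 := hsub y
    have h2 : |s * (y - x)| ≤ |y - x| := by
      rw [abs_mul]
      exact mul_le_of_le_one_left (abs_nonneg _) hs
    rw [Real.dist_eq, abs_sub_comm]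
    linarith [neg_abs_le (s * (y - x))]
  exact this.continuous

lemma eventually_lt_tanh {b β q m : ℝ} (h : m < Real.tanh (β * (q + b * m))) :
    ∀ᶠ x in nhds q, m < Real.tanh (β * (x + b * m)) := by
  have hc : Continuous fun x => Real.tanh (β * (x + b * m)) :=
    continuous_tanh.comp (by fun_prop)
  exact hc.continuousAt.eventually (lt_mem_nhds h)

lemma eventually_tanh_lt {b β q m : ℝ} (h : Real.tanh (β * (q + b * m)) < m) :
    ∀ᶠ x in nhds q, Real.tanh (β * (x + b * m)) < m := by
  have hc : Continuous fun x => Real.tanh (β * (x + b * m)) :=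
    continuous_tanh.comp (by fun_prop)
  exact hc.continuousAt.eventually (gt_mem_nhds h)

lemma IsMeanFieldRoot.le_of_tanh_lt {b β q M m : ℝ} (h : IsMeanFieldRoot b β q M)
    (hm : 0 < m) (hlt : Real.tanh (β * (q + b * m)) < m) : M ≤ m := by
  by_contra! hmM
  exact absurd (h.lt_tanh m hm hmM) (not_lt.2 hlt.le)

lemma IsMeanFieldRoot.le_of_lt_tanh {b β q M m : ℝ} (h : IsMeanFieldRoot b β q M)
    (hlt : m < Real.tanh (β * (q + b * m))) : m ≤ M := by
  by_contra! hmM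
  exact absurd (h.tanh_lt m hmM) (not_lt.2 hlt.le)

lemma IsPressure.hasDerivAt {b β p : ℝ} {f : ℝ → ℝ} (hf : IsPressure b β f) (hb : 0 < b)
    (hβ : 0 < β) (hp : IsMeanFieldRoot b β 0 p) {q M : ℝ} (hq : 0 < q)
    (h : IsMeanFieldRoot b β q M) : HasDerivAt f M q := by
  rw [hasDerivAt_iff_isLittleO, Asymptotics.isLittleO_iff]
  intro c hc
  have hd : 0 < min c (M / 2) := lt_min hc (by linarith [h.pos])
  have hd1 : min c (M / 2) ≤ c := min_le_left _ _
  have hd2 : min c (M / 2) ≤ M / 2 := min_le_right _ _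
  have hpos := h.pos
  filter_upwards [lt_mem_nhds hq,
    eventually_lt_tanh (h.lt_tanh (M - min c (M / 2)) (by linarith) (by linarith)),
    eventually_tanh_lt (h.tanh_lt (M + c) (by linarith))] with x hx h1 h2
  obtain ⟨M', hM'⟩ := exists_isMeanFieldRoot hb hβ hx
  have h3 := hM'.le_of_lt_tanh h1
  have h4 := hM'.le_of_tanh_lt (by linarith) h2
  have h5 := hf.isSubgradientAt hb hβ hp hq.le h x
  have h6 := hf.isSubgradientAt hb hβ hp hx.le hM' q
  have h7 : |M' - M| ≤ c := abs_le.2 ⟨by linarith, by linarith⟩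
  have h8 : |(M' - M) * (x - q)| ≤ c * |x - q| := by
    rw [abs_mul]
    gcongr
  have h9 := le_abs_self ((M' - M) * (x - q))
  rw [Real.norm_eq_abs, Real.norm_eq_abs, smul_eq_mul, abs_of_nonneg (by linarith)]
  linarith

lemma IsPressure.differentiableAt {b β p : ℝ} {f : ℝ → ℝ} (hf : IsPressure b β f) (hb : 0 < b)
    (hβ : 0 < β) (hp : IsMeanFieldRoot b β 0 p) {q : ℝ} (hq : q ≠ 0) :
    DifferentiableAt ℝ f q := by
  rcases lt_or_gt_of_ne hq with hq | hq
  · obtain ⟨M, hM⟩ := exists_isMeanFieldRoot hb hβ (neg_pos.2 hq)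
    have h := (hf.hasDerivAt hb hβ hp (neg_pos.2 hq) hM).differentiableAt.comp q
      differentiableAt_id.neg
    exact h.congr_of_eventuallyEq (Eventually.of_forall fun x => (hf.neg x).symm)
  · obtain ⟨M, hM⟩ := exists_isMeanFieldRoot hb hβ hq
    exact (hf.hasDerivAt hb hβ hp hq hM).differentiableAt

lemma IsPressure.le_of_isSubgradientAt_zero {b β p : ℝ} {f : ℝ → ℝ} (hf : IsPressure b β f)
    (hb : 0 < b) (hβ : 0 < β) (hp : IsMeanFieldRoot b β 0 p) {s : ℝ}
    (hs : IsSubgradientAt f 0 s) : s ≤ p := by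
  by_contra! hlt
  obtain ⟨r, hr1, hr2⟩ := exists_between hlt
  have h1 := (eventually_tanh_lt (hp.tanh_lt r hr1)).filter_mono
    (nhdsWithin_le_nhds (s := Set.Ioi 0))
  obtain ⟨q, hq1, hq⟩ := (h1.and self_mem_nhdsWithin).exists
  have hq : 0 < q := hq
  obtain ⟨M, hM⟩ := exists_isMeanFieldRoot hb hβ hq
  have h2 := hM.le_of_tanh_lt (hp.pos.trans hr1) hq1
  have h3 := hf.isSubgradientAt hb hβ hp hq.le hM 0
  have h4 := hs q
  nlinarith

lemma IsPressure.isSubgradientAt_zero_iff {b β p : ℝ} {f : ℝ → ℝ} (hf : IsPressure b β f)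
    (hb : 0 < b) (hβ : 0 < β) (hp : IsMeanFieldRoot b β 0 p) {s : ℝ} :
    IsSubgradientAt f 0 s ↔ s ∈ Set.Icc (-p) p := by
  constructor
  · intro hs
    refine ⟨?_, hf.le_of_isSubgradientAt_zero hb hβ hp hs⟩
    have h := hf.isSubgradientAt_neg hs
    rw [neg_zero] at h
    linarith [hf.le_of_isSubgradientAt_zero hb hβ hp h]
  · intro hs x
    have h1 := hf.isSubgradientAt hb hβ hp le_rfl hp
    have h2 := hf.isSubgradientAt_neg h1
    rw [neg_zero] at h2
    have h1 := h1 x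
    have h2 := h2 x
    rw [sub_zero] at *
    rcases le_total 0 x with hx | hx
    · nlinarith [hs.2]
    · nlinarith [hs.1]

section LogSumExp

variable {ι : Type*} {S : Finset ι} {c a e : ι → ℝ} {t : ℝ}

lemma sum_mul_exp_pos (hS : S.Nonempty) (hc : ∀ k ∈ S, 0 < c k) (q : ℝ) :
    0 < ∑ k ∈ S, c k * Real.exp (t * (q * a k + e k)) :=
  Finset.sum_pos (fun k hk => mul_pos (hc k hk) (Real.exp_pos _)) hS

lemma hasDerivAt_logSumExp (hS : S.Nonempty) (hc : ∀ k ∈ S, 0 < c k) (ht : 0 < t) (q : ℝ) :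
    HasDerivAt (fun q => t⁻¹ * Real.log (∑ k ∈ S, c k * Real.exp (t * (q * a k + e k))))
      ((∑ k ∈ S, c k * Real.exp (t * (q * a k + e k)) * a k) /
        ∑ k ∈ S, c k * Real.exp (t * (q * a k + e k))) q := by
  have h1 : HasDerivAt (fun q => ∑ k ∈ S, c k * Real.exp (t * (q * a k + e k)))
      (∑ k ∈ S, c k * (Real.exp (t * (q * a k + e k)) * (t * (1 * a k)))) q := by
    refine HasDerivAt.fun_sum fun k _ => ?_
    exact (((((hasDerivAt_id q).mul_const (a k)).add_const (e k)).const_mul t).exp).const_mul (c k)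
  refine ((h1.log (sum_mul_exp_pos hS hc q).ne').const_mul t⁻¹).congr_deriv ?_
  have h2 : ∑ k ∈ S, c k * (Real.exp (t * (q * a k + e k)) * (t * (1 * a k))) =
      t * ∑ k ∈ S, c k * Real.exp (t * (q * a k + e k)) * a k := by
    rw [Finset.mul_sum]
    refine Finset.sum_congr rfl fun k _ => ?_
    ring
  rw [h2]
  field_simp

lemma abs_deriv_logSumExp_le (hS : S.Nonempty) (hc : ∀ k ∈ S, 0 < c k)
    (ha : ∀ k ∈ S, |a k| ≤ 1) (ht : 0 < t) (q : ℝ) :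
    |deriv (fun q => t⁻¹ * Real.log (∑ k ∈ S, c k * Real.exp (t * (q * a k + e k)))) q| ≤ 1 := by
  have hZ := sum_mul_exp_pos (a := a) (e := e) (t := t) hS hc q
  rw [(hasDerivAt_logSumExp hS hc ht q).deriv, abs_div, abs_of_pos hZ, div_le_one hZ]
  refine (Finset.abs_sum_le_sum_abs _ _).trans (Finset.sum_le_sum fun k hk => ?_)
  have hw := mul_pos (hc k hk) (Real.exp_pos (t * (q * a k + e k)))
  rw [abs_mul, abs_of_pos hw]
  exact mul_le_of_le_one_right hw.le (ha k hk)

lemma isSubgradientAt_logSumExp (hS : S.Nonempty) (hc : ∀ k ∈ S, 0 < c k) (ht : 0 < t) (q : ℝ) :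
    IsSubgradientAt (fun q => t⁻¹ * Real.log (∑ k ∈ S, c k * Real.exp (t * (q * a k + e k)))) q
      (deriv (fun q => t⁻¹ * Real.log (∑ k ∈ S, c k * Real.exp (t * (q * a k + e k)))) q) := by
  intro x
  have hZ := sum_mul_exp_pos (a := a) (e := e) (t := t) hS hc q
  rw [(hasDerivAt_logSumExp hS hc ht q).deriv]
  set A := (∑ k ∈ S, c k * Real.exp (t * (q * a k + e k)) * a k) /
        ∑ k ∈ S, c k * Real.exp (t * (q * a k + e k)) with hA
  have hA' : ∑ k ∈ S, c k * Real.exp (t * (q * a k + e k)) * a k =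
      A * ∑ k ∈ S, c k * Real.exp (t * (q * a k + e k)) := by
    rw [hA, div_mul_cancel₀ _ hZ.ne']
  have key : (∑ k ∈ S, c k * Real.exp (t * (q * a k + e k))) * Real.exp (t * (A * (x - q))) ≤
      ∑ k ∈ S, c k * Real.exp (t * (x * a k + e k)) := by
    have h1 : ∀ k ∈ S, c k * Real.exp (t * (q * a k + e k)) * Real.exp (t * (A * (x - q))) *
        (1 + t * (x - q) * (a k - A)) ≤ c k * Real.exp (t * (x * a k + e k)) := by
      intro k hk
      have h2 := Real.add_one_le_exp (t * (x - q) * (a k - A))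
      have h3 : c k * Real.exp (t * (x * a k + e k)) =
          c k * Real.exp (t * (q * a k + e k)) * Real.exp (t * (A * (x - q))) *
            Real.exp (t * (x - q) * (a k - A)) := by
        rw [mul_assoc, mul_assoc, ← Real.exp_add, ← Real.exp_add]
        ring_nf
      have := hc k hk
      rw [h3]
      gcongr
      linarith
    refine le_trans (le_of_eq ?_) (Finset.sum_le_sum h1)
    have h4 : ∀ k, c k * Real.exp (t * (q * a k + e k)) * Real.exp (t * (A * (x - q))) *
        (1 + t * (x - q) * (a k - A)) =
        Real.exp (t * (A * (x - q))) * (1 - t * (x - q) * A) *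
          (c k * Real.exp (t * (q * a k + e k))) +
        Real.exp (t * (A * (x - q))) * (t * (x - q)) *
          (c k * Real.exp (t * (q * a k + e k)) * a k) := fun k => by ring
    simp only [h4]
    rw [Finset.sum_add_distrib, ← Finset.mul_sum, ← Finset.mul_sum, hA']
    ring
  have hlog := Real.log_le_log (mul_pos hZ (Real.exp_pos _)) key
  rw [Real.log_mul hZ.ne' (Real.exp_ne_zero _), Real.log_exp] at hlog
  have := mul_le_mul_of_nonneg_left hlog (inv_pos.2 ht).le
  rw [mul_add, inv_mul_cancel_left₀ ht.ne'] at this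
  exact this

end LogSumExp

/-- The rescaled log-partition function of the Curie–Weiss model with `N` spins. -/
noncomputable def cwFree (b β : ℝ) (N : ℕ) (q : ℝ) : ℝ :=
  (β * N)⁻¹ * Real.log (∑ k ∈ Finset.range (N + 1),
    (N.choose k : ℝ) * Real.exp (β * N *
      (q * (-1 + 2 * k / N) + b * (-1 + 2 * k / N) ^ 2 / 2)))

lemma choose_pos_of_mem_range {N : ℕ} :
    ∀ k ∈ Finset.range (N + 1), (0 : ℝ) < (N.choose k : ℝ) := by
  intro k hk
  exact_mod_cast Nat.choose_pos (Nat.lt_succ_iff.1 (Finset.mem_range.1 hk))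

lemma abs_magnetization_le {N : ℕ} (hN : 1 ≤ N) :
    ∀ k ∈ Finset.range (N + 1), |-1 + 2 * (k : ℝ) / N| ≤ 1 := by
  intro k hk
  have hk : (k : ℝ) ≤ N := by exact_mod_cast Nat.lt_succ_iff.1 (Finset.mem_range.1 hk)
  have hN : (0 : ℝ) < N := by exact_mod_cast hN
  have h1 : 2 * (k : ℝ) / N ≤ 2 := by rw [div_le_iff₀ hN]; linarith
  have h2 : 0 ≤ 2 * (k : ℝ) / N := by positivity
  exact abs_le.2 ⟨by linarith, by linarith⟩

section CwFree

variable {b β : ℝ} {N : ℕ}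

lemma differentiable_cwFree (hβ : 0 < β) (hN : 1 ≤ N) : Differentiable ℝ (cwFree b β N) := by
  have hN' : (0 : ℝ) < N := by exact_mod_cast hN
  exact fun q => (hasDerivAt_logSumExp (Finset.nonempty_range_add_one)
    choose_pos_of_mem_range (mul_pos hβ hN') q).differentiableAt

lemma abs_deriv_cwFree_le (hβ : 0 < β) (hN : 1 ≤ N) (q : ℝ) :
    |deriv (cwFree b β N) q| ≤ 1 := by
  have hN' : (0 : ℝ) < N := by exact_mod_cast hN
  exact abs_deriv_logSumExp_le (Finset.nonempty_range_add_one)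
    choose_pos_of_mem_range (abs_magnetization_le hN) (mul_pos hβ hN') q

lemma isSubgradientAt_cwFree (hβ : 0 < β) (hN : 1 ≤ N) (q : ℝ) :
    IsSubgradientAt (cwFree b β N) q (deriv (cwFree b β N) q) := by
  have hN' : (0 : ℝ) < N := by exact_mod_cast hN
  exact isSubgradientAt_logSumExp (Finset.nonempty_range_add_one)
    choose_pos_of_mem_range (mul_pos hβ hN') q

lemma sum_choose_mul_exp (hN : 1 ≤ N) (u : ℝ) :
    ∑ k ∈ Finset.range (N + 1), (N.choose k : ℝ) * Real.exp (u * N * (-1 + 2 * k / N)) =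
      (2 * Real.cosh u) ^ N := by
  have hN' : (0 : ℝ) < N := by exact_mod_cast hN
  have e : 2 * Real.cosh u = Real.exp u + Real.exp (-u) := by
    rw [Real.cosh_eq]
    ring
  rw [e, add_pow]
  refine Finset.sum_congr rfl fun k hk => ?_
  have hk : k ≤ N := Nat.lt_succ_iff.1 (Finset.mem_range.1 hk)
  rw [mul_comm, ← Real.exp_nat_mul, ← Real.exp_nat_mul, ← Real.exp_add, Nat.cast_sub hk]
  congr 2
  field_simp
  ring

lemma cwDual_mul (hβ : 0 < β) (q m : ℝ) :
    β * N * cwDual b β q m =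
      N * Real.log (2 * Real.cosh (β * (q + b * m))) - β * N * (b * m ^ 2 / 2) := by
  unfold cwDual
  field_simp

lemma exp_cwDual_mul (hβ : 0 < β) (q m : ℝ) :
    Real.exp (β * N * cwDual b β q m) =
      (2 * Real.cosh (β * (q + b * m))) ^ N * Real.exp (-(β * N * (b * m ^ 2 / 2))) := by
  rw [cwDual_mul hβ, sub_eq_add_neg, Real.exp_add, Real.exp_nat_mul,
    Real.exp_log (two_cosh_pos _)]

lemma cwDual_le_cwFree (hb : 0 < b) (hβ : 0 < β) (hN : 1 ≤ N) (q m : ℝ) :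
    cwDual b β q m ≤ cwFree b β N q := by
  have hN' : (0 : ℝ) < N := by exact_mod_cast hN
  have ht := mul_pos hβ hN'
  have key : Real.exp (β * N * cwDual b β q m) ≤ ∑ k ∈ Finset.range (N + 1),
      (N.choose k : ℝ) * Real.exp (β * N *
        (q * (-1 + 2 * k / N) + b * (-1 + 2 * k / N) ^ 2 / 2)) := by
    rw [exp_cwDual_mul hβ, ← sum_choose_mul_exp hN, Finset.sum_mul]
    refine Finset.sum_le_sum fun k _ => ?_
    rw [mul_assoc, ← Real.exp_add]
    gcongr
    have h : 0 ≤ β * N * b * ((-1 + 2 * (k : ℝ) / N) - m) ^ 2 := by positivity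
    linarith
  have h := Real.log_le_log (Real.exp_pos _) key
  rw [Real.log_exp] at h
  unfold cwFree
  rwa [← div_eq_inv_mul, le_div_iff₀' ht]

lemma cwFree_le (hβ : 0 < β) (hN : 1 ≤ N) {q B : ℝ} (hB : ∀ m, cwDual b β q m ≤ B) :
    cwFree b β N q ≤ B + β⁻¹ * (Real.log (N + 1) / N) := by
  have hN' : (0 : ℝ) < N := by exact_mod_cast hN
  have ht := mul_pos hβ hN'
  have hterm : ∀ k ∈ Finset.range (N + 1), (N.choose k : ℝ) * Real.exp (β * N *
        (q * (-1 + 2 * k / N) + b * (-1 + 2 * k / N) ^ 2 / 2)) ≤ Real.exp (β * N * B) := by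
    intro k hk
    set m : ℝ := -1 + 2 * k / N with hm
    refine le_trans ?_ (Real.exp_le_exp.2 (mul_le_mul_of_nonneg_left (hB m) ht.le))
    rw [exp_cwDual_mul hβ]
    have h1 := Finset.single_le_sum (f := fun k : ℕ => (N.choose k : ℝ) *
      Real.exp (β * (q + b * m) * N * (-1 + 2 * k / N))) (fun i _ => by positivity) hk
    rw [sum_choose_mul_exp hN] at h1
    refine le_trans (le_of_eq ?_) (mul_le_mul_of_nonneg_right h1 (Real.exp_pos _).le)
    simp only [← hm]
    rw [mul_assoc (N.choose k : ℝ), ← Real.exp_add]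
    ring_nf
  have key : ∑ k ∈ Finset.range (N + 1), (N.choose k : ℝ) * Real.exp (β * N *
        (q * (-1 + 2 * k / N) + b * (-1 + 2 * k / N) ^ 2 / 2)) ≤
      (N + 1) * Real.exp (β * N * B) := by
    refine (Finset.sum_le_card_nsmul _ _ _ hterm).trans (le_of_eq ?_)
    rw [Finset.card_range, nsmul_eq_mul]
    push_cast
    ring
  have h := Real.log_le_log (Finset.sum_pos (fun k hk =>
    mul_pos (choose_pos_of_mem_range k hk) (Real.exp_pos _)) Finset.nonempty_range_add_one) key
  rw [Real.log_mul (by positivity) (Real.exp_ne_zero _), Real.log_exp] at h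
  unfold cwFree
  rw [← div_eq_inv_mul, div_le_iff₀' ht]
  refine h.trans (le_of_eq ?_)
  field_simp
  ring

end CwFree

lemma tendsto_inv_mul_log_div (β : ℝ) :
    Tendsto (fun N : ℕ => β⁻¹ * (Real.log (N + 1) / N)) atTop (nhds 0) := by
  have h := (Real.tendsto_pow_log_div_mul_add_atTop 1 (-1) 1 one_ne_zero).comp
    (tendsto_atTop_add_const_right atTop (1 : ℝ) tendsto_natCast_atTop_atTop)
  have h2 := h.const_mul β⁻¹
  rw [mul_zero] at h2
  refine h2.congr fun N => ?_
  simp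

section ConvexLimit

variable {F : ℕ → ℝ → ℝ} {f : ℝ → ℝ} {e : ℕ → ℝ}

lemma eventually_exists_isSubgradientAt
    (he : Tendsto e atTop (nhds 0)) (hf : Continuous f)
    (hlow : ∀ᶠ N in atTop, ∀ q, f q ≤ F N q) (hupp : ∀ᶠ N in atTop, ∀ q, F N q ≤ f q + e N)
    (hbd : ∀ᶠ N in atTop, ∀ q, |deriv (F N) q| ≤ 1)
    (hsub : ∀ᶠ N in atTop, ∀ q, IsSubgradientAt (F N) q (deriv (F N) q))
    {K : Set ℝ} (hK : IsCompact K) {ε : ℝ} (hε : 0 < ε) :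
    ∀ᶠ N in atTop, ∀ q ∈ K, ∃ q' ∈ K, ∃ s, IsSubgradientAt f q' s ∧
      dist (deriv (F N) q, q, F N q) (s, q', f q') ≤ ε := by
  by_contra hcon
  rw [not_eventually] at hcon
  have hfreq := (hcon.and_eventually (hlow.and (hupp.and (hbd.and hsub))))
  obtain ⟨φ, hφ, hP⟩ := extraction_of_frequently_atTop hfreq
  choose hP hlow hupp hbd hsub using hP
  push Not at hP
  choose x hxK hx using hP
  have hmem : ∀ n, (x n, deriv (F (φ n)) (x n)) ∈ K ×ˢ Set.Icc (-1 : ℝ) 1 :=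
    fun n => ⟨hxK n, abs_le.1 (hbd n _)⟩
  obtain ⟨⟨q, s⟩, hqs, ψ, hψ, hlim⟩ := (hK.prod isCompact_Icc).tendsto_subseq hmem
  have hq : Tendsto (fun n => x (ψ n)) atTop (nhds q) :=
    (continuous_fst.tendsto _).comp hlim
  have hs : Tendsto (fun n => deriv (F (φ (ψ n))) (x (ψ n))) atTop (nhds s) :=
    (continuous_snd.tendsto _).comp hlim
  have he' : Tendsto (fun n => e (φ (ψ n))) atTop (nhds 0) :=
    he.comp (hφ.tendsto_atTop.comp hψ.tendsto_atTop)
  have hfx : Tendsto (fun n => f (x (ψ n))) atTop (nhds (f q)) := (hf.tendsto q).comp hq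
  have hFx : Tendsto (fun n => F (φ (ψ n)) (x (ψ n))) atTop (nhds (f q)) := by
    refine tendsto_of_tendsto_of_tendsto_of_le_of_le hfx ?_ (fun n => hlow _ _)
      (fun n => hupp _ _)
    simpa using hfx.add he'
  have hsubg : IsSubgradientAt f q s := by
    intro y
    have h1 : Tendsto (fun n => F (φ (ψ n)) (x (ψ n)) +
        deriv (F (φ (ψ n))) (x (ψ n)) * (y - x (ψ n))) atTop (nhds (f q + s * (y - q))) :=
      hFx.add (hs.mul (hq.const_sub y))
    have h2 : Tendsto (fun n => f y + e (φ (ψ n))) atTop (nhds (f y)) := by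
      simpa using he'.const_add (f y)
    exact le_of_tendsto_of_tendsto' h1 h2 fun n => (hsub _ _ y).trans (hupp _ y)
  have hconv := hs.prodMk_nhds (hq.prodMk_nhds hFx)
  obtain ⟨n, hn⟩ := (Metric.tendsto_nhds.1 hconv ε hε).exists
  exact absurd hn (not_lt.2 (hx (ψ n) q hqs.1 s hsubg).le)

lemma eventually_exists_dist_lt_of_interior
    (he : Tendsto e atTop (nhds 0)) (hf : Continuous f)
    (hlow : ∀ᶠ N in atTop, ∀ q, f q ≤ F N q) (hupp : ∀ᶠ N in atTop, ∀ q, F N q ≤ f q + e N)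
    (hdiff : ∀ᶠ N in atTop, Differentiable ℝ (F N))
    {K : Set ℝ} {q s : ℝ} (hK : K ∈ nhds q) (hs : IsSubgradientAt f q s) {ε : ℝ} (hε : 0 < ε) :
    ∀ᶠ N in atTop, ∃ q' ∈ K, dist (s, q, f q) (deriv (F N) q', q', F N q') < ε := by
  have hnear : ∀ᶠ x in nhds q, x ∈ K ∧ dist (f x) (f q) < ε / 2 :=
    Filter.Eventually.and hK (Metric.tendsto_nhds.1 (hf.tendsto q) (ε / 2) (by positivity))
  obtain ⟨r, hr, hball⟩ := Metric.eventually_nhds_iff.1 hnear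
  set δ := min (r / 2) (ε / 2) with hδ
  have hδ0 : 0 < δ := by positivity
  have hδr : δ < r := (min_le_left _ _).trans_lt (by linarith)
  have hδε : δ < ε := (min_le_right _ _).trans_lt (by linarith)
  filter_upwards [hlow, hupp, hdiff, he.eventually (gt_mem_nhds (show 0 < δ ^ 2 / 2 by positivity)),
    he.eventually (gt_mem_nhds (half_pos hε))] with N hlow hupp hdiff he1 he2
  have hdiff' : ∀ x, HasDerivAt (fun x => F N x - s * (x - q) + (x - q) ^ 2 / 2)
      (deriv (F N) x - s + (x - q)) x := by
    intro x
    have h0 := (hasDerivAt_id x).sub_const q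
    refine (((hdiff x).hasDerivAt.sub (h0.const_mul s)).add
      ((h0.pow 2).div_const 2)).congr_deriv ?_
    simp only [id]
    push_cast
    ring
  have hcont : Continuous fun x => F N x - s * (x - q) + (x - q) ^ 2 / 2 :=
    continuous_iff_continuousAt.2 fun x => (hdiff' x).continuousAt
  obtain ⟨x, hx, hmin⟩ := (isCompact_Icc (a := q - δ) (b := q + δ)).exists_isMinOn
    ⟨q, by linarith, by linarith⟩ hcont.continuousOn
  have hxq := isMinOn_iff.1 hmin q ⟨by linarith, by linarith⟩
  simp only [sub_self, mul_zero, sub_zero] at hxq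
  have hsq : (x - q) ^ 2 < δ ^ 2 := by
    have h1 := hs x
    have h2 := hlow x
    have h3 := hupp q
    norm_num at hxq
    linarith
  have habs : |x - q| < δ := abs_lt_of_sq_lt_sq hsq hδ0.le
  have hxq' := abs_lt.1 habs
  have hcrit := (hmin.isLocalMin (Icc_mem_nhds (by linarith) (by linarith))).hasDerivAt_eq_zero
    (hdiff' x)
  obtain ⟨hxK, hfx⟩ := hball (y := x) (by rw [Real.dist_eq]; linarith)
  refine ⟨x, hxK, ?_⟩
  rw [Prod.dist_eq, Prod.dist_eq]
  simp only [Real.dist_eq] at *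
  refine max_lt ?_ (max_lt ?_ ?_)
  · rw [show s - deriv (F N) x = x - q by linarith]
    linarith
  · rw [abs_sub_comm]
    linarith
  · have h4 := abs_lt.1 hfx
    have h5 := hlow x
    have h6 := hupp x
    exact abs_lt.2 ⟨by linarith, by linarith⟩

/-- If differentiable convex functions `F N` converge uniformly to `f` from above, then the
graphs of `(F N)'` and `F N` over a compact set `K` converge in the Hausdorff distance to the
subdifferential graph of `f` over `K`, provided `f` is differentiable at all points of `K` that are
not interior. -/
lemma tendsto_hausdorffDist_subgradient
    (he : Tendsto e atTop (nhds 0)) (hf : Continuous f)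
    (hlow : ∀ᶠ N in atTop, ∀ q, f q ≤ F N q) (hupp : ∀ᶠ N in atTop, ∀ q, F N q ≤ f q + e N)
    (hdiff : ∀ᶠ N in atTop, Differentiable ℝ (F N))
    (hbd : ∀ᶠ N in atTop, ∀ q, |deriv (F N) q| ≤ 1)
    (hsub : ∀ᶠ N in atTop, ∀ q, IsSubgradientAt (F N) q (deriv (F N) q))
    {K : Set ℝ} (hK : IsCompact K) (hfK : ∀ q ∈ K, K ∈ nhds q ∨ DifferentiableAt ℝ f q)
    (hfbd : ∀ q s, IsSubgradientAt f q s → |s| ≤ 1) :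
    Tendsto (fun N => Metric.hausdorffDist ((fun q => (deriv (F N) q, q, F N q)) '' K)
      {x : ℝ × ℝ × ℝ | x.2.1 ∈ K ∧ x.2.2 = f x.2.1 ∧ IsSubgradientAt f x.2.1 x.1})
      atTop (nhds 0) := by
  set L := {x : ℝ × ℝ × ℝ | x.2.1 ∈ K ∧ x.2.2 = f x.2.1 ∧ IsSubgradientAt f x.2.1 x.1} with hL
  have hpt : ∀ x ∈ L, ∀ ε > 0, ∀ᶠ N in atTop,
      ∃ q' ∈ K, dist x (deriv (F N) q', q', F N q') < ε := by
    rintro ⟨s, q, z⟩ ⟨hqK, hz, hs⟩ ε hε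
    simp only at hqK hz hs
    subst hz
    rcases hfK q hqK with h | h
    · exact eventually_exists_dist_lt_of_interior he hf hlow hupp hdiff h hs hε
    · filter_upwards [eventually_exists_isSubgradientAt he hf hlow hupp hbd hsub
        (isCompact_singleton (x := q)) (half_pos hε)] with N hN
      obtain ⟨q', hq', s', hs', hdist⟩ := hN q rfl
      obtain rfl : q' = q := hq'
      rw [hs.eq_of_hasDerivAt h.hasDerivAt, ← hs'.eq_of_hasDerivAt h.hasDerivAt]
      refine ⟨q', hqK, ?_⟩
      rw [dist_comm]
      linarith
  have htb : TotallyBounded L := by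
    refine ((isCompact_Icc (a := (-1 : ℝ)) (b := 1)).prod
      (hK.prod (hK.image hf))).totallyBounded.subset ?_
    rintro ⟨s, q, z⟩ ⟨hqK, hz, hs⟩
    exact ⟨abs_le.1 (hfbd _ _ hs), hqK, q, hqK, hz.symm⟩
  rw [Metric.tendsto_atTop']
  intro ε hε
  have hunif : ∀ᶠ N in atTop, ∀ x ∈ L, ∃ q' ∈ K,
      dist x (deriv (F N) q', q', F N q') ≤ ε / 2 := by
    obtain ⟨T, hTL, hT, hcover⟩ := Metric.finite_approx_of_totallyBounded htb (ε / 4)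
      (by positivity)
    filter_upwards [(Filter.eventually_all_finite hT).2 fun x hx =>
      hpt x (hTL hx) (ε / 4) (by positivity)] with N hN x hx
    obtain ⟨y, hy, hxy⟩ := Set.mem_iUnion₂.1 (hcover hx)
    obtain ⟨q', hq', hdist⟩ := hN y hy
    refine ⟨q', hq', (dist_triangle _ y _).trans ?_⟩
    have := Metric.mem_ball.1 hxy
    linarith
  have hmain : ∀ᶠ N in atTop, dist (Metric.hausdorffDist
      ((fun q => (deriv (F N) q, q, F N q)) '' K) L) 0 < ε := by
    filter_upwards [hunif, eventually_exists_isSubgradientAt he hf hlow hupp hbd hsub hK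
      (half_pos hε)] with N h1 h2
    rw [Real.dist_eq, sub_zero, abs_of_nonneg Metric.hausdorffDist_nonneg]
    refine lt_of_le_of_lt (Metric.hausdorffDist_le_of_mem_dist (half_pos hε).le ?_ ?_)
      (half_lt_self hε)
    · rintro _ ⟨q, hq, rfl⟩
      obtain ⟨q', hq', s, hs, hdist⟩ := h2 q hq
      exact ⟨(s, q', f q'), ⟨hq', rfl, hs⟩, hdist⟩
    · intro x hx
      obtain ⟨q', hq', hdist⟩ := h1 x hx
      exact ⟨_, ⟨q', hq', rfl⟩, hdist⟩
  obtain ⟨n, hn⟩ := eventually_atTop.1 hmain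
  exact ⟨n, fun m hm => hn m hm.le⟩

end ConvexLimit

lemma abs_le_one_of_isSubgradientAt {f : ℝ → ℝ}
    (h : ∀ q, ∃ s, |s| ≤ 1 ∧ IsSubgradientAt f q s) {q s : ℝ} (hs : IsSubgradientAt f q s) :
    |s| ≤ 1 := by
  obtain ⟨t, ht, hsub⟩ := h (q + 1)
  obtain ⟨t', ht', hsub'⟩ := h (q - 1)
  have h1 := hs (q + 1)
  have h2 := hsub q
  have h3 := hs (q - 1)
  have h4 := hsub' q
  have := abs_le.1 ht
  have := abs_le.1 ht'
  exact abs_le.2 ⟨by linarith, by linarith⟩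

lemma IsPressure.setOf_isSubgradientAt_eq {b β p : ℝ} {f : ℝ → ℝ} (hf : IsPressure b β f)
    (hb : 0 < b) (hβ : 0 < β) (hp : IsMeanFieldRoot b β 0 p) {K : Set ℝ} (hK : 0 ∈ K) :
    {x : ℝ × ℝ × ℝ | x.2.1 ∈ K ∧ x.2.2 = f x.2.1 ∧ IsSubgradientAt f x.2.1 x.1} =
      ((fun q => (deriv f q, q, f q)) '' (K \ {0})) ∪
        ((fun s => (s, (0 : ℝ), f 0)) '' Set.Icc (-p) p) := by
  ext ⟨s, q, z⟩
  simp only [Set.mem_ofPred_eq]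
  constructor
  · rintro ⟨hq, rfl, hs⟩
    by_cases h0 : q = 0
    · subst h0
      exact Or.inr ⟨s, (hf.isSubgradientAt_zero_iff hb hβ hp).1 hs, rfl⟩
    · refine Or.inl ⟨q, ⟨hq, h0⟩, ?_⟩
      rw [hs.eq_of_hasDerivAt (hf.differentiableAt hb hβ hp h0).hasDerivAt]
  · rintro (⟨q', ⟨hq, h0⟩, h⟩ | ⟨s', hs, h⟩)
    · obtain ⟨rfl, rfl, rfl⟩ : deriv f q' = s ∧ q' = q ∧ f q' = z := by simpa using h
      obtain ⟨t, -, ht⟩ := hf.exists_isSubgradientAt hb hβ hp q'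
      rw [← ht.eq_of_hasDerivAt (hf.differentiableAt hb hβ hp h0).hasDerivAt]
      exact ⟨hq, rfl, ht⟩
    · obtain ⟨rfl, rfl, rfl⟩ : s' = s ∧ 0 = q ∧ f 0 = z := by simpa using h
      exact ⟨hK, rfl, (hf.isSubgradientAt_zero_iff hb hβ hp).2 hs⟩

/-- Over a compact interval `I = [a, a']` containing `0` in its
interior, the rescaled equilibrium Legendrians
`Ā_N = {(f_N'(q), q, f_N(q)) : q ∈ I}` converge in the Hausdorff distance to the
union `L` of the stable branches `{(f'(q), q, f(q)) : q ∈ I, q ≠ 0}` of the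
limiting Curie–Weiss Legendrian and the vertical segment
`{(s, 0, f(0)) : s ∈ [−pPlus, pPlus]}` over `q = 0`. -/
theorem curie_weiss_legendrian_hausdorff_convergence
    (b β : ℝ) (hb : 0 < b) (hβ : 0 < β) (hbβ : 1 < b * β)
    (pPlus : ℝ) (hpPlus : pPlus ∈ Set.Ioo (0 : ℝ) 1) (hpPluseq : pPlus = Real.tanh (b * β * pPlus))
    (fN : ℕ → ℝ → ℝ)
    (hfN : ∀ N : ℕ, 1 ≤ N → ∀ q : ℝ,
      fN N q = (β * N)⁻¹ * Real.log (∑ k ∈ Finset.range (N + 1),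
        (N.choose k : ℝ) * Real.exp (β * N *
          (q * (-1 + 2 * k / N) + b * (-1 + 2 * k / N) ^ 2 / 2))))
    (f : ℝ → ℝ)
    (hf : ∀ q : ℝ, f q = sSup ((fun m => q * m + b * m ^ 2 / 2 - β⁻¹ * cEnt m) ''
      Set.Icc (-1 : ℝ) 1))
    (a a' : ℝ) (ha : a < 0) (ha' : 0 < a') :
    Tendsto (fun N : ℕ => Metric.hausdorffDist
        ((fun q => (deriv (fN N) q, q, fN N q)) '' Set.Icc a a')
        (((fun q => (deriv f q, q, f q)) '' (Set.Icc a a' \ {0})) ∪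
          ((fun s => (s, (0 : ℝ), f 0)) '' Set.Icc (-pPlus) pPlus)))
      atTop (nhds 0) := by
  have hP : IsPressure b β f := hf
  have hp : IsMeanFieldRoot b β 0 pPlus :=
    isMeanFieldRoot_of_eq hb hβ le_rfl hpPlus.1 hpPlus.2 (by
      rw [zero_add, ← mul_assoc, mul_comm β b]
      exact hpPluseq.symm)
  have hF : ∀ᶠ N in atTop, fN N = cwFree b β N := by
    filter_upwards [eventually_ge_atTop 1] with N hN
    exact funext (hfN N hN)
  have hN := eventually_ge_atTop (1 : ℕ)
  have hex := hP.exists_isSubgradientAt hb hβ hp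
  rw [← hP.setOf_isSubgradientAt_eq hb hβ hp (K := Set.Icc a a') ⟨ha.le, ha'.le⟩]
  refine (tendsto_hausdorffDist_subgradient (F := cwFree b β) (K := Set.Icc a a')
    (tendsto_inv_mul_log_div β)
    (continuous_of_exists_isSubgradientAt hex) ?_ ?_
    (hN.mono fun N hN => differentiable_cwFree hβ hN)
    (hN.mono fun N hN => abs_deriv_cwFree_le hβ hN)
    (hN.mono fun N hN => isSubgradientAt_cwFree hβ hN) isCompact_Icc ?_
    (fun q s hs => abs_le_one_of_isSubgradientAt hex hs)).congr' ?_
  · filter_upwards [hN] with N hN q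
    obtain ⟨M, hM, -⟩ := hP.exists_eq_cwDual hb hβ hp q
    exact hM ▸ cwDual_le_cwFree hb hβ hN q M
  · filter_upwards [hN] with N hN q
    obtain ⟨-, -, hM⟩ := hP.exists_eq_cwDual hb hβ hp q
    exact cwFree_le hβ hN hM
  · intro q _
    by_cases h0 : q = 0
    · exact Or.inl (h0 ▸ Icc_mem_nhds ha ha')
    · exact Or.inr (hP.differentiableAt hb hβ hp h0)
  · filter_upwards [hF] with N hN
    rw [hN]
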